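/- Fix k ≥ 1 and let W_k be a k×k Hermitian random matrix. Let (A_n)_{n≥1}, (B_n)_{n≥1} be sequences of n×n Hermitian random matrices such that for every real t there is a probability measure ψ(t;·) on ℝ with almost sure convergence in moments of μ_{A_n + tB_n} to ψ(t;·) as n → ∞, where the supports of ψ(t;·) are uniformly bounded for t in compact subsets of ℝ. Set 𝔹_{n,k} = I_k ⊗ A_n + W_k ⊗ B_n. Then almost surely, for every integer m ≥ 1, lim_{n→∞} tr_{nk}(𝔹_{n,k}^m) = ∫_ℝ ∫_ℝ x^m ψ(t;dx) μ_{W_k}(dt). -/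

import Mathlib

open MeasureTheory ProbabilityTheory Matrix Filter Topology Kronecker
open scoped ENNReal NNReal

noncomputable section

instance matrixMeasurableSpace {m n α : Type*} [MeasurableSpace α] :
    MeasurableSpace (Matrix m n α) :=
  inferInstanceAs (MeasurableSpace (m → n → α))

/-- The (normalized) spectral measure of a matrix: the empirical eigenvalue
distribution if the matrix is Hermitian, the zero measure otherwise. -/
noncomputable def specMeasure {ι : Type*} [Fintype ι] [DecidableEq ι]
    (A : Matrix ι ι ℂ) : Measure ℝ :=
  if h : A.IsHermitian then
    ((Fintype.card ι : ℝ≥0∞))⁻¹ • ∑ i : ι, Measure.dirac (h.eigenvalues i)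
  else 0

/-- The normalized trace `tr_N(M) = trace(M)/N` (real part). -/
noncomputable def ntrace {ι : Type*} [Fintype ι] (M : Matrix ι ι ℂ) : ℝ :=
  (Matrix.trace M).re / (Fintype.card ι)

/-- Weak convergence of a sequence of measures on `ℝ`: convergence of the
integrals of all bounded continuous functions. -/
def WeakLim (μs : ℕ → Measure ℝ) (ν : Measure ℝ) : Prop :=
  ∀ f : BoundedContinuousFunction ℝ ℝ,
    Tendsto (fun n => ∫ x, f x ∂(μs n)) atTop (𝓝 (∫ x, f x ∂ν))

/-- Convergence in moments of a sequence of measures on `ℝ`. -/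
def MomentLim (μs : ℕ → Measure ℝ) (ν : Measure ℝ) : Prop :=
  ∀ m : ℕ, 1 ≤ m →
    Tendsto (fun n => ∫ x, x ^ m ∂(μs n)) atTop (𝓝 (∫ x, x ^ m ∂ν))

/-- A power of `A + t B` has entries that are polynomial in `t`, of degree at most the exponent. -/
lemma exists_polynomial_entry_pow {ι : Type*} [Fintype ι] [DecidableEq ι] (A B : Matrix ι ι ℂ)
    (m : ℕ) (i j : ι) :
    ∃ p : Polynomial ℂ, p.natDegree ≤ m ∧ ∀ t : ℂ, ((A + t • B) ^ m) i j = p.eval t := by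
  induction m generalizing i j with
  | zero => exact ⟨Polynomial.C ((1 : Matrix ι ι ℂ) i j), by simp, by simp⟩
  | succ m ih =>
    choose p hdeg heval using ih
    refine ⟨∑ l, p i l * (Polynomial.C (A l j) + Polynomial.C (B l j) * Polynomial.X), ?_, ?_⟩
    · refine Polynomial.natDegree_sum_le_of_forall_le _ _ fun l _ => ?_
      refine Polynomial.natDegree_mul_le_of_le (hdeg i l) ?_
      rw [add_comm]
      exact Polynomial.natDegree_linear_le
    · intro t
      simp [pow_succ, Matrix.mul_apply, heval, Polynomial.eval_finsetSum, mul_comm t]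

/-- The real part of a complex polynomial on the real line is a real polynomial. -/
lemma exists_polynomial_eval_eq_re (p : Polynomial ℂ) :
    ∃ q : Polynomial ℝ, q.natDegree ≤ p.natDegree ∧ ∀ t : ℝ, q.eval t = (p.eval (t : ℂ)).re := by
  refine ⟨∑ i ∈ Finset.range (p.natDegree + 1), Polynomial.C (p.coeff i).re * Polynomial.X ^ i,
    ?_, ?_⟩
  · refine Polynomial.natDegree_sum_le_of_forall_le _ _ fun i hi => ?_
    exact (Polynomial.natDegree_C_mul_X_pow_le _ _).trans
      (Nat.lt_succ_iff.mp (Finset.mem_range.mp hi))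
  · intro t
    rw [Polynomial.eval_finsetSum, Polynomial.eval_eq_sum_range, Complex.re_sum]
    refine Finset.sum_congr rfl fun i _ => ?_
    rw [← Complex.ofReal_pow, Complex.re_mul_ofReal]
    simp

/-- The normalized trace of `(A + t B) ^ m` is a polynomial in `t` of degree at most `m`. -/
lemma exists_polynomial_ntrace_pow {ι : Type*} [Fintype ι] [DecidableEq ι] (A B : Matrix ι ι ℂ)
    (m : ℕ) :
    ∃ q : Polynomial ℝ, q.natDegree ≤ m ∧
      ∀ t : ℝ, ntrace ((A + (t : ℂ) • B) ^ m) = q.eval t := by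
  choose p hdeg heval using exists_polynomial_entry_pow A B m
  obtain ⟨q, hq, hqe⟩ := exists_polynomial_eval_eq_re (∑ i, p i i)
  refine ⟨Polynomial.C (Fintype.card ι : ℝ)⁻¹ * q, ?_, fun t => ?_⟩
  · exact (Polynomial.natDegree_C_mul_le _ _).trans
      (hq.trans (Polynomial.natDegree_sum_le_of_forall_le _ _ fun i _ => hdeg i i))
  · simp only [ntrace, Matrix.trace, Matrix.diag_apply, hqe, heval, Polynomial.eval_finsetSum,
      Polynomial.eval_mul, Polynomial.eval_C, div_eq_inv_mul]

/-- Lagrange interpolation of `t ↦ ntrace ((A + t B) ^ m)` at the nodes `0, …, m`. -/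
lemma ntrace_pow_eq_sum_basis {ι : Type*} [Fintype ι] [DecidableEq ι] (A B : Matrix ι ι ℂ)
    (m : ℕ) (t : ℝ) :
    ntrace ((A + (t : ℂ) • B) ^ m) =
      ∑ i ∈ Finset.range (m + 1), ntrace ((A + (((i : ℕ) : ℝ) : ℂ) • B) ^ m) *
        (Lagrange.basis (Finset.range (m + 1)) (fun j : ℕ => (j : ℝ)) i).eval t := by
  obtain ⟨q, hdeg, hq⟩ := exists_polynomial_ntrace_pow A B m
  have h := Lagrange.eq_interpolate (s := Finset.range (m + 1)) (v := fun j : ℕ => (j : ℝ)) (f := q)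
    (Nat.cast_injective.injOn) (by
      rw [Finset.card_range]
      exact Polynomial.degree_le_natDegree.trans_lt (by exact_mod_cast Nat.lt_succ_of_le hdeg))
  simp only [hq]
  conv_lhs => rw [h]
  simp [Lagrange.interpolate_apply, Polynomial.eval_finsetSum]

lemma trace_pow_eq_sum_eigenvalues_pow {ι : Type*} [Fintype ι] [DecidableEq ι] {A : Matrix ι ι ℂ}
    (hA : A.IsHermitian) (m : ℕ) :
    (A ^ m).trace = ∑ i, ((hA.eigenvalues i : ℂ)) ^ m := by
  conv_lhs => rw [hA.spectral_theorem, ← map_pow, Unitary.conjStarAlgAut_apply,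
    Matrix.trace_mul_cycle]
  simp [Matrix.diagonal_pow, Matrix.trace_diagonal]

lemma integral_specMeasure {ι : Type*} [Fintype ι] [DecidableEq ι] {A : Matrix ι ι ℂ}
    (hA : A.IsHermitian) (f : ℝ → ℝ) :
    ∫ x, f x ∂(specMeasure A) = (∑ i, f (hA.eigenvalues i)) / Fintype.card ι := by
  rw [specMeasure, dif_pos hA, integral_smul_measure, integral_finsetSum_measure]
  · simp [div_eq_inv_mul]
  · intro i _
    exact integrable_dirac (by simp)

lemma integral_pow_specMeasure {ι : Type*} [Fintype ι] [DecidableEq ι] {A : Matrix ι ι ℂ}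
    (hA : A.IsHermitian) (m : ℕ) :
    ∫ x, x ^ m ∂(specMeasure A) = ntrace (A ^ m) := by
  rw [integral_specMeasure hA, ntrace, trace_pow_eq_sum_eigenvalues_pow hA, Complex.re_sum]
  simp [← Complex.ofReal_pow]

lemma pow_one_kronecker_add_diagonal_kronecker_apply {κ ι : Type*} [Fintype κ] [DecidableEq κ]
    [Fintype ι] [DecidableEq ι] (d : κ → ℂ) (A B : Matrix ι ι ℂ) (m : ℕ) (i j : κ) (a b : ι) :
    (((1 : Matrix κ κ ℂ) ⊗ₖ A + diagonal d ⊗ₖ B) ^ m) (i, a) (j, b) =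
      if i = j then ((A + d i • B) ^ m) a b else 0 := by
  induction m generalizing j b with
  | zero => by_cases h : i = j <;> simp [Matrix.one_apply, h]
  | succ m ih =>
    rw [pow_succ, Matrix.mul_apply, Fintype.sum_prod_type]
    simp only [ih]
    by_cases h : i = j
    · subst h
      simp [pow_succ, Matrix.mul_apply]
    · simp [h]

lemma trace_pow_one_kronecker_add_kronecker {κ ι : Type*} [Fintype κ] [DecidableEq κ]
    [Fintype ι] [DecidableEq ι] {W : Matrix κ κ ℂ} (hW : W.IsHermitian) (A B : Matrix ι ι ℂ)
    (m : ℕ) :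
    (((1 : Matrix κ κ ℂ) ⊗ₖ A + W ⊗ₖ B) ^ m).trace =
      ∑ i, ((A + (hW.eigenvalues i : ℂ) • B) ^ m).trace := by
  set d : κ → ℂ := fun i => (hW.eigenvalues i : ℂ) with hd
  set U : Matrix κ κ ℂ := (hW.eigenvectorUnitary : Matrix κ κ ℂ) with hU
  have hUU : U * star U = 1 := Unitary.coe_mul_star_self _
  have hUU' : star U * U = 1 := Unitary.coe_star_mul_self _
  have hWU : W * U = U * diagonal d := by
    have h : W = U * diagonal d * star U := by
      conv_lhs => rw [hW.spectral_theorem, Unitary.conjStarAlgAut_apply]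
      rfl
    conv_lhs => rw [h]
    rw [mul_assoc, hUU', mul_one]
  have hsemi : SemiconjBy (U ⊗ₖ (1 : Matrix ι ι ℂ))
      ((1 : Matrix κ κ ℂ) ⊗ₖ A + diagonal d ⊗ₖ B) ((1 : Matrix κ κ ℂ) ⊗ₖ A + W ⊗ₖ B) := by
    simp only [SemiconjBy, mul_add, add_mul, ← Matrix.mul_kronecker_mul, hWU, one_mul, mul_one]
  have hinv : U ⊗ₖ (1 : Matrix ι ι ℂ) * star U ⊗ₖ (1 : Matrix ι ι ℂ) = 1 := by
    rw [← Matrix.mul_kronecker_mul, hUU, one_mul, Matrix.one_kronecker_one]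
  have hinv' : star U ⊗ₖ (1 : Matrix ι ι ℂ) * U ⊗ₖ (1 : Matrix ι ι ℂ) = 1 := by
    rw [← Matrix.mul_kronecker_mul, hUU', one_mul, Matrix.one_kronecker_one]
  have hpow := (hsemi.pow_right m).eq
  rw [← mul_one (((1 : Matrix κ κ ℂ) ⊗ₖ A + W ⊗ₖ B) ^ m), ← hinv, ← mul_assoc, ← hpow,
    Matrix.trace_mul_comm, ← mul_assoc, hinv', one_mul]
  simp [Matrix.trace, Fintype.sum_prod_type, pow_one_kronecker_add_diagonal_kronecker_apply, hd]

lemma ntrace_pow_one_kronecker_add_kronecker {κ ι : Type*} [Fintype κ] [DecidableEq κ]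
    [Fintype ι] [DecidableEq ι] {W : Matrix κ κ ℂ} (hW : W.IsHermitian) (A B : Matrix ι ι ℂ)
    (m : ℕ) :
    ntrace (((1 : Matrix κ κ ℂ) ⊗ₖ A + W ⊗ₖ B) ^ m) =
      (∑ i, ntrace ((A + (hW.eigenvalues i : ℂ) • B) ^ m)) / Fintype.card κ := by
  simp only [ntrace, trace_pow_one_kronecker_add_kronecker hW, Complex.re_sum, Fintype.card_prod,
    Nat.cast_mul, ← Finset.sum_div]
  rw [div_div, mul_comm]

/-- Almost sure convergence of the moments of `A_n + t B_n` for each `t` upgrades to almost sure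
convergence for all `t` simultaneously, since these moments are polynomial in `t`. -/
lemma ae_forall_tendsto_ntrace_pow {Ω : Type*} [MeasurableSpace Ω] (P : Measure Ω)
    [IsProbabilityMeasure P] (A B : (n : ℕ) → Ω → Matrix (Fin n) (Fin n) ℂ) (φ : ℝ → ℝ) (m : ℕ)
    (h : ∀ t : ℝ, ∀ᵐ ω ∂P,
      Tendsto (fun n => ntrace ((A n ω + (t : ℂ) • B n ω) ^ m)) atTop (𝓝 (φ t))) :
    ∀ᵐ ω ∂P, ∀ t : ℝ,
      Tendsto (fun n => ntrace ((A n ω + (t : ℂ) • B n ω) ^ m)) atTop (𝓝 (φ t)) := by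
  let L : ℝ → ℝ := fun t => ∑ i ∈ Finset.range (m + 1), φ i *
    (Lagrange.basis (Finset.range (m + 1)) (fun j : ℕ => (j : ℝ)) i).eval t
  have hL : ∀ᵐ ω ∂P, ∀ t : ℝ,
      Tendsto (fun n => ntrace ((A n ω + (t : ℂ) • B n ω) ^ m)) atTop (𝓝 (L t)) := by
    filter_upwards [ae_all_iff.mpr fun i : ℕ => h i] with ω hω t
    simp only [ntrace_pow_eq_sum_basis _ _ m t]
    exact tendsto_finsetSum _ fun i _ => (hω i).mul_const _
  have hφ : ∀ t, φ t = L t := fun t => by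
    obtain ⟨ω, hω, hω'⟩ := ((h t).and hL).exists
    exact tendsto_nhds_unique hω (hω' t)
  simpa only [hφ] using hL

/-- Fix `k ≥ 1` and a Hermitian random matrix `W` of order `k`.
Let `A_n, B_n` be Hermitian random matrices of order `n` such that for every
real `t`, almost surely the spectral measures of `A_n + t B_n` converge in
moments to a probability measure `ψ t`, with supports uniformly bounded for
`t` in compact sets. Then almost surely, for every `m ≥ 1`,
`tr_{nk}((I_k ⊗ A_n + W ⊗ B_n)^m) → ∫ (∫ x^m dψ(t)) dμ_W(t)` as `n → ∞`. -/
theorem trace_limit_in_n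
    {Ω : Type*} [MeasurableSpace Ω] (P : Measure Ω) [IsProbabilityMeasure P]
    {k : ℕ} (hk : 1 ≤ k)
    (W : Ω → Matrix (Fin k) (Fin k) ℂ) (hWherm : ∀ ω, (W ω).IsHermitian)
    (A B : (n : ℕ) → Ω → Matrix (Fin n) (Fin n) ℂ)
    (hAherm : ∀ n ω, (A n ω).IsHermitian)
    (hBherm : ∀ n ω, (B n ω).IsHermitian)
    (ψ : ℝ → Measure ℝ) (hψprob : ∀ t, IsProbabilityMeasure (ψ t))
    (hψ : ∀ t : ℝ, ∀ᵐ ω ∂P,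
      MomentLim (fun n => specMeasure (A n ω + (t : ℂ) • B n ω)) (ψ t))
    (hψunif : ∀ C : Set ℝ, IsCompact C →
      ∃ M : ℝ, 0 < M ∧ ∀ t ∈ C, ψ t (Set.Icc (-M) M) = 1) :
    ∀ᵐ ω ∂P, ∀ m : ℕ, 1 ≤ m →
      Tendsto
        (fun n => ntrace (((1 : Matrix (Fin k) (Fin k) ℂ) ⊗ₖ A n ω + W ω ⊗ₖ B n ω) ^ m))
        atTop
        (𝓝 (∫ t, (∫ x, x ^ m ∂(ψ t)) ∂(specMeasure (W ω)))) := by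
  have hmom : ∀ m : ℕ, ∀ᵐ ω ∂P, 1 ≤ m → ∀ t : ℝ,
      Tendsto (fun n => ntrace ((A n ω + (t : ℂ) • B n ω) ^ m)) atTop
        (𝓝 (∫ x, x ^ m ∂(ψ t))) := fun m => by
    by_cases hm : 1 ≤ m
    · have h := ae_forall_tendsto_ntrace_pow P A B (fun t => ∫ x, x ^ m ∂(ψ t)) m fun t => by
        filter_upwards [hψ t] with ω hω
        refine (hω m hm).congr fun n => integral_pow_specMeasure ?_ m
        exact (hAherm n ω).add ((hBherm n ω).smul (Complex.conj_ofReal t))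
      filter_upwards [h] with ω hω _ using hω
    · exact Eventually.of_forall fun ω hm' => absurd hm' hm
  filter_upwards [ae_all_iff.mpr hmom] with ω hω m hm
  simp only [ntrace_pow_one_kronecker_add_kronecker (hWherm ω), integral_specMeasure (hWherm ω)]
  exact (tendsto_finsetSum _ fun i _ => hω m hm _).div_const _
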